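/- arXiv:2506.02042 — 3 statements merged into one kernel-verified Lean document; each statement's English description precedes it below -/
import Mathlib

section
/- Let N be a submultiplicative, unitarily invariant norm on the n×n complex matrices, let m ≥ 1, and let α_j ∈ [0, π/2) for j = 1, …, m. If X_j ∈ M^s_{n,α_j} for each j, then ω_N(X₁ ∘ X₂ ∘ ⋯ ∘ X_m) ≤ (∏_{j=1}^m sec(α_j)) · ω_N(X₁)·ω_N(X₂)⋯ω_N(X_m). -/
open scoped ComplexOrder Matrix

/-- The Hermitian (real) part of a matrix: `Re(X) = (X + X*)/2`. -/
noncomputable def matRe {n : ℕ} (X : Matrix (Fin n) (Fin n) ℂ) :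
    Matrix (Fin n) (Fin n) ℂ :=
  (1 / 2 : ℂ) • (X + Xᴴ)

/-- The skew (imaginary) part of a matrix: `Im(X) = (X - X*)/(2i)`. -/
noncomputable def matIm {n : ℕ} (X : Matrix (Fin n) (Fin n) ℂ) :
    Matrix (Fin n) (Fin n) ℂ :=
  (1 / (2 * Complex.I)) • (X - Xᴴ)

/-- The generalized numerical radius induced by a norm `N`:
`ω_N(X) = sup_θ N(Re(e^{iθ} X))`. -/
noncomputable def gnr {n : ℕ} (N : Matrix (Fin n) (Fin n) ℂ → ℝ)
    (X : Matrix (Fin n) (Fin n) ℂ) : ℝ :=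
  ⨆ θ : ℝ, N (matRe (Complex.exp (θ * Complex.I) • X))

/-- The numerical range `W(X) = {⟨Xx, x⟩ : ‖x‖ = 1}` (standard inner product on ℂⁿ). -/
def numRange {n : ℕ} (X : Matrix (Fin n) (Fin n) ℂ) : Set ℂ :=
  { z | ∃ x : Fin n → ℂ, star x ⬝ᵥ x = 1 ∧ z = star x ⬝ᵥ X.mulVec x }

/-- The sector `S_α = {z : Re z > 0, |Im z| ≤ tan(α) Re z}`. -/
def sector (α : ℝ) : Set ℂ :=
  { z | 0 < z.re ∧ |z.im| ≤ Real.tan α * z.re }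

/-- The class `M^s_{n,α}` of matrices `X` such that `W(zX) ⊆ S_α` for some unimodular `z`. -/
def sectClass (n : ℕ) (α : ℝ) : Set (Matrix (Fin n) (Fin n) ℂ) :=
  { X | ∃ z : ℂ, ‖z‖ = 1 ∧ numRange (z • X) ⊆ sector α }


open Matrix

structure UIN {n : ℕ} (N : Matrix (Fin n) (Fin n) ℂ → ℝ) : Prop where
  z : ∀ A : Matrix (Fin n) (Fin n) ℂ, N A = 0 ↔ A = 0
  s : ∀ (c : ℂ) (A : Matrix (Fin n) (Fin n) ℂ), N (c • A) = ‖c‖ * N A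
  a : ∀ A B : Matrix (Fin n) (Fin n) ℂ, N (A + B) ≤ N A + N B
  ui : ∀ U V A : Matrix (Fin n) (Fin n) ℂ, U ∈ Matrix.unitaryGroup (Fin n) ℂ →
      V ∈ Matrix.unitaryGroup (Fin n) ℂ → N (U * A * V) = N A
  sm : ∀ A B : Matrix (Fin n) (Fin n) ℂ, N (A * B) ≤ N A * N B

namespace UIN

variable {n : ℕ} {N : Matrix (Fin n) (Fin n) ℂ → ℝ}

lemma nonneg (h : UIN N) (A : Matrix (Fin n) (Fin n) ℂ) : 0 ≤ N A := by
  have h1 := h.a A ((-1 : ℂ) • A)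
  have h2 := h.s (-1) A
  have h3 : A + (-1 : ℂ) • A = 0 := by simp
  rw [h3, (h.z 0).2 rfl, h2] at h1
  simp at h1
  linarith

lemma half (h : UIN N) (A B : Matrix (Fin n) (Fin n) ℂ) (c : ℝ) (hA : N A ≤ c) (hB : N B ≤ c) :
    N ((1 / 2 : ℂ) • (A + B)) ≤ c := by
  rw [h.s]
  have := h.a A B
  have h2 : ‖(1 / 2 : ℂ)‖ = 1 / 2 := by norm_num
  rw [h2]
  linarith

lemma diag_unit (d : Fin n → ℂ) (hd : ∀ i, star (d i) * d i = 1) :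
    diagonal d ∈ Matrix.unitaryGroup (Fin n) ℂ := by
  rw [Matrix.mem_unitaryGroup_iff', Matrix.star_eq_conjTranspose, diagonal_conjTranspose,
    diagonal_mul_diagonal, ← diagonal_one]
  congr 1
  ext i
  exact hd i

/-- multiplication by a real diagonal contraction. -/
lemma mul_contr (h : UIN N) (A : Matrix (Fin n) (Fin n) ℂ) (d : Fin n → ℝ)
    (hd : ∀ i, |d i| ≤ 1) : N (A * diagonal (fun i => (d i : ℂ))) ≤ N A := by
  set u : Fin n → ℂ := fun i => ⟨d i, Real.sqrt (1 - d i ^ 2)⟩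
  have hu : ∀ i, star (u i) * u i = 1 := by
    intro i
    have h1 : 0 ≤ 1 - d i ^ 2 := by
      have := sq_le_one_iff_abs_le_one (d i) |>.2 (hd i)
      linarith
    have h2 := Real.mul_self_sqrt h1
    apply Complex.ext
    · simp [u]; nlinarith
    · simp [u]; ring
  have hu' : ∀ i, star (star (u i)) * star (u i) = 1 := by
    intro i; rw [star_star, mul_comm]; exact hu i
  have e : A * diagonal (fun i => (d i : ℂ)) =
      (1 / 2 : ℂ) • (1 * A * diagonal u + 1 * A * diagonal (fun i => star (u i))) := by
    ext i j
    have : (d j : ℂ) = (1 / 2) * (u j + star (u j)) := by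
      apply Complex.ext <;> simp [u]; ring
    simp only [mul_diagonal, Matrix.smul_apply, Matrix.add_apply, one_mul, smul_eq_mul]
    rw [this]; ring
  rw [e]
  apply h.half
  · exact (h.ui _ _ _ (one_mem _) (diag_unit _ hu)).le
  · exact (h.ui _ _ _ (one_mem _) (diag_unit _ hu')).le

lemma pinch_aux (h : UIN N) (A : Matrix (Fin n) (Fin n) ℂ) (s : Finset (Fin n)) :
    N (Matrix.of fun i j => if i ≠ j ∧ (i ∈ s ∨ j ∈ s) then 0 else A i j) ≤ N A := by
  induction s using Finset.induction_on with
  | empty =>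
    apply le_of_eq; congr 1; ext i j; simp
  | insert k s hk ih =>
    set B : Matrix (Fin n) (Fin n) ℂ :=
      Matrix.of fun i j => if i ≠ j ∧ (i ∈ s ∨ j ∈ s) then 0 else A i j with hB
    set u : Fin n → ℂ := fun i => if i = k then -1 else 1 with hu
    have hU : diagonal u ∈ Matrix.unitaryGroup (Fin n) ℂ := by
      apply diag_unit
      intro i; by_cases hi : i = k <;> simp [hu, hi]
    have e : (Matrix.of fun i j => if i ≠ j ∧ (i ∈ insert k s ∨ j ∈ insert k s) then 0 else A i j)
        = (1 / 2 : ℂ) • (B + diagonal u * B * diagonal u) := by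
      ext i j
      simp only [mul_diagonal, diagonal_mul, Matrix.smul_apply, Matrix.add_apply, smul_eq_mul, hB, of_apply, hu,
        Finset.mem_insert]
      by_cases hij : i = j
      · subst hij
        by_cases hi : i = k <;> simp [hi] <;> ring
      · by_cases hi : i = k <;> by_cases hj : j = k <;> simp [hij, hi, hj] 
        · exact absurd (hi.trans hj.symm) hij
        · have hkj : k ≠ j := fun h => hj h.symm
          simp [hkj]
          split_ifs <;> ring
        · split_ifs <;> ring
    rw [e]
    apply h.half _ _ _ ih
    rw [h.ui _ _ _ hU hU]
    exact ih

lemma pinch (h : UIN N) (A : Matrix (Fin n) (Fin n) ℂ) :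
    N (diagonal (fun i => A i i)) ≤ N A := by
  refine le_trans (le_of_eq ?_) (h.pinch_aux A Finset.univ)
  congr 1
  ext i j
  by_cases hij : i = j
  · subst hij; simp
  · simp [hij]

lemma spec {H : Matrix (Fin n) (Fin n) ℂ} (hH : H.IsHermitian) :
    ∃ U ∈ Matrix.unitaryGroup (Fin n) ℂ, ∃ d : Fin n → ℝ,
      Uᴴ * H * U = diagonal (fun i => (d i : ℂ)) := by
  refine ⟨hH.eigenvectorUnitary, hH.eigenvectorUnitary.2, hH.eigenvalues, ?_⟩
  have := hH.conjStarAlgAut_star_eigenvectorUnitary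
  rw [Unitary.conjStarAlgAut_star_apply] at this
  exact this

lemma conj_mem {U : Matrix (Fin n) (Fin n) ℂ} (hU : U ∈ Matrix.unitaryGroup (Fin n) ℂ) :
    Uᴴ ∈ Matrix.unitaryGroup (Fin n) ℂ := Unitary.star_mem hU

lemma mono (h : UIN N) {H P : Matrix (Fin n) (Fin n) ℂ} (hH : H.IsHermitian)
    (h1 : (P - H).PosSemidef) (h2 : (P + H).PosSemidef) : N H ≤ N P := by
  obtain ⟨U, hU, d, hd⟩ := spec hH
  have hU' := conj_mem hU
  have q1 := h1.conjTranspose_mul_mul_same U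
  have q2 := h2.conjTranspose_mul_mul_same U
  rw [mul_sub, sub_mul, hd] at q1
  rw [mul_add, add_mul, hd] at q2
  set Q := Uᴴ * P * U with hQ
  have hNP : N Q = N P := h.ui _ _ _ hU' hU
  have hNH : N (diagonal (fun i => (d i : ℂ))) = N H := by rw [← hd]; exact h.ui _ _ _ hU' hU
  have k : ∀ i, (Q i i).im = 0 ∧ |d i| ≤ (Q i i).re := by
    intro i
    have a1 := q1.diag_nonneg (i := i)
    have a2 := q2.diag_nonneg (i := i)
    simp [Complex.le_def] at a1 a2
    refine ⟨a2.2.symm, abs_le.2 ⟨by linarith, by linarith⟩⟩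
  set c : Fin n → ℝ := fun i => d i / (Q i i).re
  have hc : ∀ i, |c i| ≤ 1 := by
    intro i
    have := (k i).2
    have h0 : 0 ≤ (Q i i).re := (abs_nonneg _).trans this
    simp only [c, abs_div, abs_of_nonneg h0]
    exact div_le_one_of_le₀ this h0
  have e : diagonal (fun i => (d i : ℂ)) =
      diagonal (fun i => Q i i) * diagonal (fun i => (c i : ℂ)) := by
    rw [diagonal_mul_diagonal]
    congr 1
    ext i
    have hq : Q i i = ((Q i i).re : ℂ) := by
      apply Complex.ext <;> simp [(k i).1]
    rw [hq, ← Complex.ofReal_mul]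
    congr 1
    simp only [c]
    by_cases h0 : (Q i i).re = 0
    · have := (k i).2
      rw [h0] at this
      simp [abs_nonpos_iff.1 this, h0]
    · field_simp
  rw [← hNH, ← hNP, e]
  exact (h.mul_contr _ _ hc).trans (h.pinch Q)

lemma eig_le (h : UIN N) {B : Matrix (Fin n) (Fin n) ℂ} (hB : B.IsHermitian) :
    (((N B : ℝ) : ℂ) • (1 : Matrix (Fin n) (Fin n) ℂ) - B).PosSemidef := by
  obtain ⟨U, hU, d, hd⟩ := spec hB
  have hU' := conj_mem hU
  have hNB : N (diagonal (fun i => (d i : ℂ))) = N B := by rw [← hd]; exact h.ui _ _ _ hU' hU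
  have hle : ∀ i, d i ≤ N B := by
    intro i
    set E : Matrix (Fin n) (Fin n) ℂ := diagonal (fun j => ((if j = i then (1 : ℝ) else 0 : ℝ) : ℂ))
      with hE
    have hE0 : E ≠ 0 := by
      intro h0
      have := congrFun (congrFun h0 i) i
      simp [hE] at this
    have hEE : E * E = E := by
      rw [hE, diagonal_mul_diagonal]
      congr 1; ext j; by_cases hj : j = i <;> simp [hj]
    have hEp : 0 < N E := lt_of_le_of_ne (h.nonneg E) (fun h0 => hE0 ((h.z E).1 h0.symm))
    have hE1 : 1 ≤ N E := by
      have := h.sm E E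
      rw [hEE] at this
      nlinarith
    have hm := h.mul_contr (diagonal (fun i => (d i : ℂ))) (fun j => if j = i then (1 : ℝ) else 0)
      (by intro j; by_cases hj : j = i <;> simp [hj])
    have e : diagonal (fun i => (d i : ℂ)) * E = (d i : ℂ) • E := by
      rw [hE, diagonal_mul_diagonal, ← diagonal_smul]
      congr 1; ext j; by_cases hj : j = i <;> simp [hj]
    rw [← hE, e, h.s, hNB, Complex.norm_real, Real.norm_eq_abs] at hm
    have := le_abs_self (d i)
    have := abs_nonneg (d i)
    nlinarith
  have hp : (diagonal (fun i => ((N B - d i : ℝ) : ℂ))).PosSemidef := by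
    rw [posSemidef_diagonal_iff]
    intro i
    exact_mod_cast sub_nonneg.2 (hle i)
  have := hp.mul_mul_conjTranspose_same U
  have hUU : U * Uᴴ = 1 := Matrix.mem_unitaryGroup_iff.1 hU
  convert this using 1
  have e : diagonal (fun i => ((N B - d i : ℝ) : ℂ)) =
      ((N B : ℝ) : ℂ) • (1 : Matrix (Fin n) (Fin n) ℂ) - Uᴴ * B * U := by
    rw [hd]; ext i j; by_cases hij : i = j
    · subst hij; simp
    · simp [hij]
  rw [e, mul_sub, sub_mul]
  congr 1
  · simp [hUU]
  · calc B = (U * Uᴴ) * B * (U * Uᴴ) := by simp [hUU]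
      _ = _ := by simp only [mul_assoc]

lemma had (h : UIN N) {A B : Matrix (Fin n) (Fin n) ℂ} (hA : A.PosSemidef) (hB : B.PosSemidef) :
    N (A ⊙ B) ≤ N A * N B := by
  have h1 := hA.hadamard (h.eig_le hB.isHermitian)
  have hAB := hA.hadamard hB
  set D : Matrix (Fin n) (Fin n) ℂ := ((N B : ℝ) : ℂ) • diagonal (fun i => A i i) with hD
  have e : A ⊙ (((N B : ℝ) : ℂ) • (1 : Matrix (Fin n) (Fin n) ℂ) - B) = D - A ⊙ B := by
    ext i j
    by_cases hij : i = j
    · subst hij; simp [hD]; ring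
    · simp [hD, hij]
  rw [e] at h1
  have h2 : (D + A ⊙ B).PosSemidef := by
    have := (h1.add hAB).add hAB
    simpa using this
  have h3 := h.mono hAB.isHermitian h1 h2
  have h4 : N D ≤ N B * N A := by
    rw [hD, h.s, Complex.norm_real, Real.norm_eq_abs, abs_of_nonneg (h.nonneg B)]
    exact mul_le_mul_of_nonneg_left (h.pinch A) (h.nonneg B)
  linarith [mul_comm (N A) (N B)]

end UIN

lemma psd_prod {ι κ : Type*} [Fintype ι] (s : Finset κ) (hs : s.Nonempty) (A : κ → Matrix ι ι ℂ)
    (hA : ∀ j, (A j).PosSemidef) : (Matrix.of fun i k => ∏ j ∈ s, A j i k).PosSemidef := by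
  classical
  induction hs using Finset.Nonempty.cons_induction with
  | singleton a => simp only [Finset.prod_singleton]; exact hA a
  | cons a s ha hs ih =>
    have e : (Matrix.of fun i k => ∏ j ∈ Finset.cons a s ha, A j i k) =
      (A a) ⊙ (Matrix.of fun i k => ∏ j ∈ s, A j i k) := by
      ext i k; simp [Finset.prod_insert ha]
    rw [e]
    exact (hA a).hadamard ih

lemma norm_prod_le' {n : ℕ} {N : Matrix (Fin n) (Fin n) ℂ → ℝ} (h : UIN N) {κ : Type*}
    (s : Finset κ) (hs : s.Nonempty) (A : κ → Matrix (Fin n) (Fin n) ℂ)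
    (hA : ∀ j, (A j).PosSemidef) :
    N (Matrix.of fun i k => ∏ j ∈ s, A j i k) ≤ ∏ j ∈ s, N (A j) := by
  classical
  induction hs using Finset.Nonempty.cons_induction with
  | singleton a => simp; rfl
  | cons a s ha hs ih =>
    have e : (Matrix.of fun i k => ∏ j ∈ Finset.cons a s ha, A j i k) =
      (A a) ⊙ (Matrix.of fun i k => ∏ j ∈ s, A j i k) := by
      ext i k; simp [Finset.prod_insert ha]
    rw [e, Finset.prod_cons]
    exact (h.had (hA a) (psd_prod s hs A hA)).trans
      (mul_le_mul_of_nonneg_left ih (h.nonneg _))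

lemma quad_star {n : ℕ} (Z : Matrix (Fin n) (Fin n) ℂ) (x : Fin n → ℂ) :
    star x ⬝ᵥ Zᴴ.mulVec x = star (star x ⬝ᵥ Z.mulVec x) := by
  rw [star_dotProduct, star_mulVec, conjTranspose_conjTranspose, ← dotProduct_mulVec]

lemma re_herm {n : ℕ} (Z : Matrix (Fin n) (Fin n) ℂ) : (matRe Z).IsHermitian := by
  ext i j; simp [matRe, conjTranspose_apply]; ring

lemma im_herm {n : ℕ} (Z : Matrix (Fin n) (Fin n) ℂ) : (matIm Z).IsHermitian := by
  ext i j; simp [matIm, conjTranspose_apply]; ring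

lemma quad_re {n : ℕ} (Z : Matrix (Fin n) (Fin n) ℂ) (x : Fin n → ℂ) :
    star x ⬝ᵥ (matRe Z).mulVec x = ((star x ⬝ᵥ Z.mulVec x).re : ℂ) := by
  rw [matRe, smul_mulVec, add_mulVec, dotProduct_smul, dotProduct_add, quad_star]
  apply Complex.ext <;> simp; ring

lemma quad_im {n : ℕ} (Z : Matrix (Fin n) (Fin n) ℂ) (x : Fin n → ℂ) :
    star x ⬝ᵥ (matIm Z).mulVec x = ((star x ⬝ᵥ Z.mulVec x).im : ℂ) := by
  rw [matIm, smul_mulVec, sub_mulVec, dotProduct_smul, dotProduct_sub, quad_star]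
  apply Complex.ext <;> simp; ring

lemma re_add_im' {n : ℕ} (Z : Matrix (Fin n) (Fin n) ℂ) : Z = matRe Z + Complex.I • matIm Z := by
  ext i j
  simp [matRe, matIm]
  ring_nf
  simp
  ring

lemma re_sub_im' {n : ℕ} (Z : Matrix (Fin n) (Fin n) ℂ) :
    Zᴴ = matRe Z - Complex.I • matIm Z := by
  ext i j
  simp [matRe, matIm]
  ring_nf
  simp
  ring

lemma psd_of_unit {n : ℕ} {M : Matrix (Fin n) (Fin n) ℂ} (hM : M.IsHermitian)
    (h : ∀ x : Fin n → ℂ, star x ⬝ᵥ x = 1 → 0 ≤ star x ⬝ᵥ M.mulVec x) : M.PosSemidef := by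
  refine .of_dotProduct_mulVec_nonneg hM fun x => ?_
  by_cases hx : x = 0
  · simp [hx]
  have h0 : 0 < star x ⬝ᵥ x := dotProduct_star_self_pos_iff.2 hx
  obtain ⟨h0r, h0i⟩ := Complex.lt_def.1 h0
  simp only [Complex.zero_re, Complex.zero_im] at h0r h0i
  set r := (star x ⬝ᵥ x).re with hr
  have hxr : star x ⬝ᵥ x = (r : ℂ) := by apply Complex.ext <;> simp [hr, ← h0i]
  set c : ℂ := (((Real.sqrt r)⁻¹ : ℝ) : ℂ) with hc
  have hcs : star c = c := Complex.conj_ofReal _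
  have hcc : c * c * r = 1 := by
    rw [hc, ← Complex.ofReal_mul, ← Complex.ofReal_mul, ← mul_inv, Real.mul_self_sqrt h0r.le,
      inv_mul_cancel₀ h0r.ne']
    simp
  have := h (c • x) (by
    rw [star_smul, smul_dotProduct, dotProduct_smul, hcs, hxr, smul_eq_mul, smul_eq_mul,
      ← mul_assoc, hcc])
  rw [star_smul, mulVec_smul, smul_dotProduct, dotProduct_smul, hcs, smul_eq_mul, smul_eq_mul,
    ← mul_assoc] at this
  have h5 := mul_nonneg h0.le this
  rw [hxr, ← mul_assoc, mul_comm (r : ℂ), hcc, one_mul] at h5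
  exact h5

lemma sect_re {n : ℕ} {Z : Matrix (Fin n) (Fin n) ℂ} {α : ℝ}
    (hZ : numRange Z ⊆ sector α) : (matRe Z).PosSemidef := by
  refine psd_of_unit (re_herm Z) fun x hx => ?_
  rw [quad_re]
  have := (hZ ⟨x, hx, rfl⟩).1
  exact_mod_cast this.le

lemma sect_pm {n : ℕ} {Z : Matrix (Fin n) (Fin n) ℂ} {α : ℝ} (h1 : 0 < Real.cos α)
    (hZ : numRange Z ⊆ sector α) (σ : ℝ) (hσ : |σ| = 1) :
    (((Real.sin α : ℝ) : ℂ) • matRe Z + ((σ * Real.cos α : ℝ) : ℂ) • matIm Z).PosSemidef := by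
  refine psd_of_unit ?_ fun x hx => ?_
  · apply IsHermitian.add
    · rw [IsHermitian, conjTranspose_smul, (re_herm Z).eq]; congr 1; exact Complex.conj_ofReal _
    · rw [IsHermitian, conjTranspose_smul, (im_herm Z).eq]; congr 1; exact Complex.conj_ofReal _
  rw [add_mulVec, dotProduct_add, smul_mulVec, smul_mulVec, dotProduct_smul, dotProduct_smul,
    quad_re, quad_im, smul_eq_mul, smul_eq_mul]
  have h2 := (hZ ⟨x, hx, rfl⟩).2
  set z := star x ⬝ᵥ Z.mulVec x
  rw [Real.tan_eq_sin_div_cos] at h2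
  have h3 : Real.cos α * |z.im| ≤ Real.sin α * z.re := by
    have := mul_le_mul_of_nonneg_left h2 h1.le
    calc _ ≤ _ := this
      _ = _ := by field_simp
  have h4 : |σ * Real.cos α * z.im| = Real.cos α * |z.im| := by
    rw [abs_mul, abs_mul, hσ, abs_of_pos h1, one_mul]
  have h5 := neg_abs_le (σ * Real.cos α * z.im)
  have : 0 ≤ Real.sin α * z.re + σ * Real.cos α * z.im := by linarith
  exact_mod_cast this

lemma block_u {n : ℕ} {A : Matrix (Fin n) (Fin n) ℂ} (hA : A.PosSemidef) (u : ℂ)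
    (hu : star u * u = 1) : (fromBlocks A (u • A) (star u • A) A).PosSemidef := by
  convert hA.conjTranspose_mul_mul_same (fromCols (1 : Matrix (Fin n) (Fin n) ℂ) (u • (1 : Matrix (Fin n) (Fin n) ℂ))) using 1
  rw [conjTranspose_fromCols_eq_fromRows_conjTranspose, fromRows_mul, fromRows_mul_fromCols]
  simp only [conjTranspose_one, one_mul, mul_one, conjTranspose_smul, smul_mul_assoc,
    mul_smul_comm, smul_smul, mul_comm u, hu, one_smul]

lemma sect_block {n : ℕ} {Z : Matrix (Fin n) (Fin n) ℂ} {α : ℝ} (h0 : 0 ≤ α)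
    (h1 : α < Real.pi / 2) (hZ : numRange Z ⊆ sector α) :
    (fromBlocks ((((Real.cos α)⁻¹ : ℝ) : ℂ) • matRe Z) Z Zᴴ
      ((((Real.cos α)⁻¹ : ℝ) : ℂ) • matRe Z)).PosSemidef := by
  have hc : 0 < Real.cos α := Real.cos_pos_of_mem_Ioo ⟨by linarith [Real.pi_pos], h1⟩
  have hA := sect_pm hc hZ 1 (by simp)
  have hB := sect_pm hc hZ (-1) (by simp)
  have eZ := re_add_im' Z
  have eZ' := re_sub_im' Z
  have hR := sect_re hZ
  generalize matRe Z = R at *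
  generalize matIm Z = S at *
  rcases h0.eq_or_lt with h0 | h0
  · subst h0
    simp only [Real.sin_zero, Real.cos_zero, mul_one, Complex.ofReal_zero, zero_smul, zero_add,
      Complex.ofReal_one, one_smul, Complex.ofReal_neg, neg_smul] at hA hB
    have hS : S = 0 := by
      open scoped MatrixOrder in
      exact le_antisymm (neg_nonneg.1 hB.nonneg) hA.nonneg
    have := block_u hR 1 (by simp)
    rw [hS, smul_zero, add_zero] at eZ
    rw [hS, smul_zero, sub_zero] at eZ'
    rw [eZ', eZ]
    simpa using this
  · have hs : 0 < Real.sin α := Real.sin_pos_of_pos_of_lt_pi h0 (by linarith [Real.pi_pos])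
    set u : ℂ := ⟨Real.cos α, Real.sin α⟩ with hu
    have hu1 : star u * u = 1 := by
      apply Complex.ext
      · simp [hu]; nlinarith [Real.sin_sq_add_cos_sq α]
      · simp [hu]; ring
    have b1 := block_u hA u hu1
    have b2 := block_u hB (star u) (by rw [star_star, mul_comm]; exact hu1)
    have k : (0 : ℂ) ≤ ((1 / (2 * Real.sin α * Real.cos α) : ℝ) : ℂ) := by
      have : 0 ≤ 1 / (2 * Real.sin α * Real.cos α) := by positivity
      exact_mod_cast this
    have b3 := (b1.add b2).smul k
    have hs' : ((Real.sin α : ℝ) : ℂ) ≠ 0 := by exact_mod_cast hs.ne'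
    have hc' : ((Real.cos α : ℝ) : ℂ) ≠ 0 := by exact_mod_cast hc.ne'
    have hu2 : u = (Real.cos α : ℝ) + (Real.sin α : ℝ) * Complex.I := by
      apply Complex.ext <;> simp [hu, -Complex.ofReal_cos, -Complex.ofReal_sin]
    have hu3 : star u = (Real.cos α : ℝ) - (Real.sin α : ℝ) * Complex.I := by
      apply Complex.ext <;> simp [hu, -Complex.ofReal_cos, -Complex.ofReal_sin]
    rw [star_star, hu3, hu2] at b3
    rw [eZ', eZ]
    convert b3 using 1
    rw [fromBlocks_add, fromBlocks_smul]
    generalize Real.sin α = s at *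
    generalize Real.cos α = c at *
    congr 1 <;>
    · ext i j
      simp only [Matrix.smul_apply, Matrix.add_apply, Matrix.sub_apply, smul_eq_mul, Complex.ofReal_mul,
        Complex.ofReal_div, Complex.ofReal_inv, Complex.ofReal_one, Complex.ofReal_neg,
        Complex.ofReal_ofNat]
      field_simp
      ring

lemma compress {n : ℕ} {P Y Y' : Matrix (Fin n) (Fin n) ℂ} (h : (fromBlocks P Y Y' P).PosSemidef)
    (hY : Y' = Yᴴ) (w : ℂ) (hw : star w * w = 1) : (P + matRe (w • Y)).PosSemidef := by
  have h2 := h.conjTranspose_mul_mul_same (fromRows (1 : Matrix (Fin n) (Fin n) ℂ) (w • (1 : Matrix (Fin n) (Fin n) ℂ)))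
  have k : (0 : ℂ) ≤ ((1 / 2 : ℝ) : ℂ) := by
    rw [Complex.zero_le_real]; norm_num
  convert h2.smul k using 1
  rw [conjTranspose_fromRows_eq_fromCols_conjTranspose, Matrix.mul_assoc, fromBlocks_mul_fromRows,
    fromCols_mul_fromRows, hY]
  simp only [conjTranspose_one, one_mul, mul_one, conjTranspose_smul, smul_mul_assoc,
    mul_smul_comm, smul_smul, smul_add, hw, one_smul, matRe]
  ext i j
  simp
  ring

lemma le_gnr {n : ℕ} {N : Matrix (Fin n) (Fin n) ℂ → ℝ} (h : UIN N)
    (X : Matrix (Fin n) (Fin n) ℂ) (z : ℂ) (hz : ‖z‖ = 1) : N (matRe (z • X)) ≤ gnr N X := by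
  have hb : BddAbove (Set.range fun θ : ℝ => N (matRe (Complex.exp (θ * Complex.I) • X))) := by
    refine ⟨max (N X) (N Xᴴ), ?_⟩
    rintro _ ⟨θ, rfl⟩
    have h1 := Complex.norm_exp_ofReal_mul_I θ
    apply h.half
    · rw [h.s, h1, one_mul]; exact le_max_left _ _
    · rw [conjTranspose_smul, h.s, norm_star, h1, one_mul]; exact le_max_right _ _
  have e : Complex.exp ((z.arg : ℝ) * Complex.I) = z := by
    have := Complex.norm_mul_exp_arg_mul_I z
    rw [hz] at this
    simpa using this
  have := le_ciSup hb z.arg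
  simp only [e] at this
  exact this

theorem stmt_12 {n : ℕ} (N : Matrix (Fin n) (Fin n) ℂ → ℝ)
    (hN0 : ∀ A : Matrix (Fin n) (Fin n) ℂ, N A = 0 ↔ A = 0)
    (hNs : ∀ (c : ℂ) (A : Matrix (Fin n) (Fin n) ℂ), N (c • A) = ‖c‖ * N A)
    (hNa : ∀ A B : Matrix (Fin n) (Fin n) ℂ, N (A + B) ≤ N A + N B)
    (hUI : ∀ U V A : Matrix (Fin n) (Fin n) ℂ, U ∈ Matrix.unitaryGroup (Fin n) ℂ →
      V ∈ Matrix.unitaryGroup (Fin n) ℂ → N (U * A * V) = N A)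
    (hSM : ∀ A B : Matrix (Fin n) (Fin n) ℂ, N (A * B) ≤ N A * N B)
    {m : ℕ} (hm : 1 ≤ m) (α : Fin m → ℝ)
    (hα : ∀ j, 0 ≤ α j ∧ α j < Real.pi / 2)
    (X : Fin m → Matrix (Fin n) (Fin n) ℂ)
    (hX : ∀ j, X j ∈ sectClass n (α j)) :
    gnr N (Matrix.of fun i k => ∏ j, X j i k) ≤
      (∏ j, (Real.cos (α j))⁻¹) * ∏ j, gnr N (X j) := by
  have h : UIN N := ⟨hN0, hNs, hNa, hUI, hSM⟩
  choose z hz hzX using hX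
  have hne : (Finset.univ : Finset (Fin m)).Nonempty := ⟨⟨0, hm⟩, Finset.mem_univ _⟩
  set R : Fin m → Matrix (Fin n) (Fin n) ℂ := fun j => matRe (z j • X j) with hR
  have hRp : ∀ j, (R j).PosSemidef := fun j => sect_re (hzX j)
  have hblk := psd_prod Finset.univ hne _ (fun j => sect_block (hα j).1 (hα j).2 (hzX j))
  set Y : Matrix (Fin n) (Fin n) ℂ := Matrix.of fun i k => ∏ j, X j i k with hY
  set Q : Matrix (Fin n) (Fin n) ℂ := Matrix.of fun i k => ∏ j, R j i k with hQ
  set P : Matrix (Fin n) (Fin n) ℂ := ((∏ j, (Real.cos (α j))⁻¹ : ℝ) : ℂ) • Q with hP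
  have eb : (Matrix.of fun i k => ∏ j, (fromBlocks ((((Real.cos (α j))⁻¹ : ℝ) : ℂ) • matRe (z j • X j))
      (z j • X j) (z j • X j)ᴴ ((((Real.cos (α j))⁻¹ : ℝ) : ℂ) • matRe (z j • X j))) i k) =
      fromBlocks P ((∏ j, z j) • Y) ((∏ j, z j) • Y)ᴴ P := by
    ext i k
    rcases i with i | i <;> rcases k with k | k <;>
      simp [hP, hQ, hY, hR, Finset.prod_mul_distrib, -Complex.ofReal_cos]
  rw [eb] at hblk
  have hpz : ‖∏ j, z j‖ = 1 := by rw [norm_prod]; simp [hz]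
  have hcos : 0 ≤ ∏ j, (Real.cos (α j))⁻¹ := by
    refine Finset.prod_nonneg fun j _ => inv_nonneg.2 ?_
    exact Real.cos_nonneg_of_mem_Icc ⟨by linarith [Real.pi_pos, (hα j).1], (hα j).2.le⟩
  have hNP : N P ≤ (∏ j, (Real.cos (α j))⁻¹) * ∏ j, gnr N (X j) := by
    rw [hP, h.s, Complex.norm_real, Real.norm_eq_abs, abs_of_nonneg hcos]
    refine mul_le_mul_of_nonneg_left ?_ hcos
    refine (norm_prod_le' h Finset.univ hne R hRp).trans ?_
    exact Finset.prod_le_prod (fun j _ => h.nonneg _) (fun j _ => le_gnr h _ _ (hz j))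
  refine ciSup_le fun θ => le_trans ?_ hNP
  have hsm : ∀ c : ℂ, ‖c‖ = 1 → star c * c = 1 := by
    intro c hc
    have := Complex.conj_mul' c
    rw [hc] at this
    simpa using this
  set w : ℂ := Complex.exp (θ * Complex.I) * star (∏ j, z j) with hw
  have hwn : ‖w‖ = 1 := by
    rw [hw, norm_mul, norm_star, hpz, Complex.norm_exp_ofReal_mul_I, one_mul]
  have ew : Complex.exp (θ * Complex.I) • Y = w • ((∏ j, z j) • Y) := by
    rw [smul_smul, hw, mul_assoc, hsm _ hpz, mul_one]
  rw [ew]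
  refine h.mono (re_herm _) ?_ (compress hblk rfl w (hsm _ hwn))
  have := compress hblk rfl (-w) (hsm _ (by rw [norm_neg, hwn]))
  have e2 : matRe (-w • ((∏ j, z j) • Y)) = - matRe (w • ((∏ j, z j) • Y)) := by
    simp only [matRe, neg_smul, conjTranspose_neg, ← neg_add, smul_neg]
  rw [e2, ← sub_eq_add_neg] at this
  exact this
end

section
/- Let N be a unitarily invariant norm on the n×n complex matrices. If X, Y ∈ M_n with Y = [y_{ij}] positive definite, then ω_N(X ∘ Y) ≤ (max_i y_{ii}) · ω_N(X). -/
open scoped ComplexOrder Matrix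

section helpers

variable {n : ℕ}

/-- A unitarily invariant norm, bundled as a hypothesis. -/
structure UINorm (N : Matrix (Fin n) (Fin n) ℂ → ℝ) : Prop where
  zero : ∀ A : Matrix (Fin n) (Fin n) ℂ, N A = 0 ↔ A = 0
  smul : ∀ (c : ℂ) (A : Matrix (Fin n) (Fin n) ℂ), N (c • A) = ‖c‖ * N A
  add : ∀ A B : Matrix (Fin n) (Fin n) ℂ, N (A + B) ≤ N A + N B
  inv : ∀ U V A : Matrix (Fin n) (Fin n) ℂ, U ∈ Matrix.unitaryGroup (Fin n) ℂ →
      V ∈ Matrix.unitaryGroup (Fin n) ℂ → N (U * A * V) = N A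

variable {N : Matrix (Fin n) (Fin n) ℂ → ℝ}

lemma diag_unitary (u : Fin n → ℂ) (hu : ∀ i, u i * star (u i) = 1) :
    Matrix.diagonal u ∈ Matrix.unitaryGroup (Fin n) ℂ := by
  rw [Matrix.mem_unitaryGroup_iff, Matrix.star_eq_conjTranspose, Matrix.diagonal_conjTranspose,
    Matrix.diagonal_mul_diagonal, ← Matrix.diagonal_one]
  congr 1
  funext i
  exact hu i

lemma cos_avg (d : Fin n → ℝ) (h0 : ∀ i, 0 ≤ d i) (h1 : ∀ i, d i ≤ 1) :
    ∃ U V : Matrix (Fin n) (Fin n) ℂ, U ∈ Matrix.unitaryGroup (Fin n) ℂ ∧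
      V ∈ Matrix.unitaryGroup (Fin n) ℂ ∧
      Matrix.diagonal (fun i => (d i : ℂ)) = (1 / 2 : ℂ) • (U + V) := by
  have key : ∀ t : ℝ, Complex.exp (t * Complex.I) * star (Complex.exp (t * Complex.I)) = 1 := by
    intro t
    rw [Complex.star_def, Complex.mul_conj, Complex.normSq_eq_norm_sq,
      Complex.norm_exp_ofReal_mul_I]
    simp
  refine ⟨Matrix.diagonal fun i => Complex.exp ((Real.arccos (d i) : ℝ) * Complex.I),
    Matrix.diagonal fun i => Complex.exp ((-Real.arccos (d i) : ℝ) * Complex.I),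
    diag_unitary _ fun i => key _, diag_unitary _ fun i => key _, ?_⟩
  rw [Matrix.diagonal_add, ← Matrix.diagonal_smul]
  congr 1
  funext i
  have h : d i = Real.cos (Real.arccos (d i)) :=
    (Real.cos_arccos (by linarith [h0 i]) (h1 i)).symm
  conv_lhs => rw [h]
  rw [Complex.ofReal_cos, Complex.cos]
  simp
  ring

lemma contr_left (hN : UINorm N) (d : Fin n → ℝ) (h0 : ∀ i, 0 ≤ d i) (h1 : ∀ i, d i ≤ 1)
    (A : Matrix (Fin n) (Fin n) ℂ) :
    N (Matrix.diagonal (fun i => (d i : ℂ)) * A) ≤ N A := by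
  obtain ⟨U, V, hU, hV, h⟩ := cos_avg d h0 h1
  rw [h, Matrix.smul_mul, hN.smul, add_mul]
  have h2 := hN.add (U * A) (V * A)
  have h3 := hN.inv U 1 A hU (one_mem _)
  have h4 := hN.inv V 1 A hV (one_mem _)
  rw [mul_one] at h3 h4
  have : ‖(1 / 2 : ℂ)‖ = 1 / 2 := by simp
  rw [this]
  linarith

lemma contr_right (hN : UINorm N) (d : Fin n → ℝ) (h0 : ∀ i, 0 ≤ d i) (h1 : ∀ i, d i ≤ 1)
    (A : Matrix (Fin n) (Fin n) ℂ) :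
    N (A * Matrix.diagonal (fun i => (d i : ℂ))) ≤ N A := by
  obtain ⟨U, V, hU, hV, h⟩ := cos_avg d h0 h1
  rw [h, Matrix.mul_smul, hN.smul, mul_add]
  have h2 := hN.add (A * U) (A * V)
  have h3 := hN.inv 1 U A (one_mem _) hU
  have h4 := hN.inv 1 V A (one_mem _) hV
  rw [one_mul] at h3 h4
  have : ‖(1 / 2 : ℂ)‖ = 1 / 2 := by simp
  rw [this]
  linarith

lemma diag_perm (hN : UINorm N) (l : Fin n → ℂ) (σ : Equiv.Perm (Fin n)) :
    N (Matrix.diagonal fun i => l (σ i)) = N (Matrix.diagonal l) := by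
  have hP : (1 : Matrix (Fin n) (Fin n) ℂ).submatrix σ id ∈ Matrix.unitaryGroup (Fin n) ℂ := by
    rw [Matrix.mem_unitaryGroup_iff, Matrix.star_eq_conjTranspose, Matrix.conjTranspose_submatrix,
      Matrix.conjTranspose_one]
    ext i j
    simp [Matrix.mul_apply, Matrix.one_apply]
  have hQ : (1 : Matrix (Fin n) (Fin n) ℂ).submatrix id σ ∈ Matrix.unitaryGroup (Fin n) ℂ := by
    have := Unitary.star_mem hP
    rwa [Matrix.star_eq_conjTranspose, Matrix.conjTranspose_submatrix,
      Matrix.conjTranspose_one] at this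
  rw [← hN.inv _ _ (Matrix.diagonal l) hP hQ]
  congr 1
  have : (Matrix.diagonal fun i => l (σ i)) = (Matrix.diagonal l).submatrix σ σ := by
    ext i j
    simp [Matrix.diagonal_apply]
  rw [this]
  ext i j
  simp [Matrix.mul_apply, Matrix.one_apply, Matrix.diagonal_apply]
  split_ifs with h
  · rw [h]
  · rfl

lemma diag_ds (hN : UINorm N) (l : Fin n → ℝ) (M : Matrix (Fin n) (Fin n) ℝ)
    (hM : M ∈ doublyStochastic ℝ (Fin n)) :
    N (Matrix.diagonal fun i => ((∑ j, M i j * l j : ℝ) : ℂ)) ≤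
      N (Matrix.diagonal fun i => (l i : ℂ)) := by
  rw [← SetLike.mem_coe, doublyStochastic_eq_convexHull_permMatrix] at hM
  have hc : Convex ℝ {M : Matrix (Fin n) (Fin n) ℝ |
      N (Matrix.diagonal fun i => ((∑ j, M i j * l j : ℝ) : ℂ)) ≤
      N (Matrix.diagonal fun i => (l i : ℂ))} := by
    intro A hA B hB a b ha hb hab
    simp only [Set.mem_ofPred_eq] at hA hB ⊢
    have : (Matrix.diagonal fun i => ((∑ j, (a • A + b • B) i j * l j : ℝ) : ℂ)) =
        (a : ℂ) • (Matrix.diagonal fun i => ((∑ j, A i j * l j : ℝ) : ℂ)) +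
        (b : ℂ) • (Matrix.diagonal fun i => ((∑ j, B i j * l j : ℝ) : ℂ)) := by
      rw [← Matrix.diagonal_smul, ← Matrix.diagonal_smul, Matrix.diagonal_add]
      congr 1
      funext i
      simp [add_mul, Finset.sum_add_distrib, Finset.mul_sum, mul_assoc]
    rw [this]
    refine (hN.add _ _).trans ?_
    rw [hN.smul, hN.smul, Complex.norm_real, Complex.norm_real, Real.norm_of_nonneg ha,
      Real.norm_of_nonneg hb]
    have h1 := mul_le_mul_of_nonneg_left hA ha
    have h2 := mul_le_mul_of_nonneg_left hB hb
    calc _ ≤ _ := add_le_add h1 h2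
      _ = _ := by rw [← add_mul, hab, one_mul]
  refine convexHull_min ?_ hc hM
  rintro _ ⟨σ, rfl⟩
  simp only [Set.mem_ofPred_eq]
  rw [← diag_perm hN (fun i => (l i : ℂ)) σ]
  apply le_of_eq
  congr 2
  funext i
  simp [Equiv.Perm.permMatrix, PEquiv.toMatrix_apply, Equiv.toPEquiv_apply, eq_comm]

lemma corr (hN : UINorm N) (H Z : Matrix (Fin n) (Fin n) ℂ) (hH : H.IsHermitian)
    (hZ : Z.PosSemidef) (hd : ∀ i, Z i i = 1) :
    N (Matrix.hadamard H Z) ≤ N H := by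
  have hK : (Matrix.hadamard H Z).IsHermitian := by
    ext i j
    have h1 := congrFun (congrFun hH i) j
    have h2 := congrFun (congrFun hZ.1 i) j
    simp only [Matrix.conjTranspose_apply, Matrix.hadamard_apply, star_mul'] at *
    rw [h1, h2]
  obtain ⟨U, hU, l, hl⟩ : ∃ U ∈ Matrix.unitaryGroup (Fin n) ℂ, ∃ l : Fin n → ℝ,
      H = U * Matrix.diagonal (fun i => (l i : ℂ)) * star U :=
    ⟨_, hH.eigenvectorUnitary.2, hH.eigenvalues, by
      conv_lhs => rw [hH.spectral_theorem]
      rfl⟩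
  obtain ⟨V, hV, m, hm⟩ : ∃ U ∈ Matrix.unitaryGroup (Fin n) ℂ, ∃ l : Fin n → ℝ,
      Matrix.hadamard H Z = U * Matrix.diagonal (fun i => (l i : ℂ)) * star U :=
    ⟨_, hK.eigenvectorUnitary.2, hK.eigenvalues, by
      conv_lhs => rw [hK.spectral_theorem]
      rfl⟩
  have eH : N H = N (Matrix.diagonal (fun i => (l i : ℂ))) := by
    rw [hl]; exact hN.inv _ _ _ hU (Unitary.star_mem hU)
  have eK : N (Matrix.hadamard H Z) = N (Matrix.diagonal (fun i => (m i : ℂ))) := by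
    rw [hm]; exact hN.inv _ _ _ hV (Unitary.star_mem hV)
  have hU1 := (Matrix.mem_unitaryGroup_iff).1 hU
  have hU2 := (Matrix.mem_unitaryGroup_iff').1 hU
  have hV1 := (Matrix.mem_unitaryGroup_iff).1 hV
  have hV2 := (Matrix.mem_unitaryGroup_iff').1 hV
  have hD : Matrix.diagonal (fun i => (m i : ℂ)) = star V * Matrix.hadamard H Z * V := by
    rw [hm]
    calc _ = 1 * Matrix.diagonal (fun i => (m i : ℂ)) * 1 := by simp
      _ = (star V * V) * Matrix.diagonal (fun i => (m i : ℂ)) * (star V * V) := by rw [hV2]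
      _ = _ := by simp only [mul_assoc]
  let C : Fin n → Fin n → ℂ := fun k j =>
    ∑ a, ∑ b, star (V a k) * (U a j * star (U b j) * Z a b) * V b k
  have hC0 : ∀ k j, 0 ≤ C k j := by
    intro k j
    have := hZ.dotProduct_mulVec_nonneg (fun b => star (U b j) * V b k)
    convert this using 1
    simp only [C, dotProduct, Matrix.mulVec, Finset.mul_sum, Pi.star_apply, star_mul', star_star]
    refine Finset.sum_congr rfl fun a _ => Finset.sum_congr rfl fun b _ => ?_
    ring
  have hCr : ∀ k j, ((C k j).re : ℂ) = C k j := by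
    intro k j
    have := (Complex.le_def.1 (hC0 k j)).2
    apply Complex.ext <;> simp
    simpa using this
  have hUe : ∀ a b, ∑ j, U a j * star (U b j) = if a = b then 1 else 0 := by
    intro a b
    have := congrFun (congrFun hU1 a) b
    simpa [Matrix.mul_apply, Matrix.one_apply] using this
  have hVe : ∀ a b, ∑ j, V a j * star (V b j) = if a = b then 1 else 0 := by
    intro a b
    have := congrFun (congrFun hV1 a) b
    simpa [Matrix.mul_apply, Matrix.one_apply] using this
  have hUe' : ∀ j, ∑ a, star (U a j) * U a j = 1 := by
    intro a
    have := congrFun (congrFun hU2 a) a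
    simpa [Matrix.mul_apply, Matrix.one_apply] using this
  have hVe' : ∀ j, ∑ a, star (V a j) * V a j = 1 := by
    intro a
    have := congrFun (congrFun hV2 a) a
    simpa [Matrix.mul_apply, Matrix.one_apply] using this
  have hrow : ∀ k, ∑ j, C k j = 1 := by
    intro k
    have : ∑ j, C k j =
        ∑ a, ∑ b, star (V a k) * ((∑ j, U a j * star (U b j)) * Z a b) * V b k := by
      simp only [C, Finset.sum_mul, Finset.mul_sum]
      rw [Finset.sum_comm]
      refine Finset.sum_congr rfl fun a _ => ?_
      rw [Finset.sum_comm]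
    rw [this]
    simp only [hUe]
    refine Eq.trans ?_ (hVe' k)
    refine Finset.sum_congr rfl fun a _ => ?_
    simp [hd]
  have hcol : ∀ j, ∑ k, C k j = 1 := by
    intro j
    have : ∑ k, C k j =
        ∑ a, ∑ b, (U a j * star (U b j) * Z a b) * ∑ k, V b k * star (V a k) := by
      simp only [C, Finset.mul_sum]
      rw [Finset.sum_comm]
      refine Finset.sum_congr rfl fun a _ => ?_
      rw [Finset.sum_comm]
      refine Finset.sum_congr rfl fun b _ => Finset.sum_congr rfl fun k _ => ?_
      ring
    rw [this]
    simp only [hVe]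
    refine Eq.trans ?_ (hUe' j)
    refine Finset.sum_congr rfl fun a _ => ?_
    simp [hd, mul_comm]
  have hmk : ∀ k, (m k : ℂ) = ∑ j, C k j * l j := by
    intro k
    have h1 := congrFun (congrFun hD k) k
    rw [Matrix.diagonal_apply_eq] at h1
    rw [h1]
    have h2 : ∀ a b, H a b = ∑ j, U a j * star (U b j) * l j := by
      intro a b
      have := congrFun (congrFun hl a) b
      rw [this, Matrix.mul_apply]
      refine Finset.sum_congr rfl fun j _ => ?_
      rw [Matrix.mul_diagonal, Matrix.star_apply]
      ring
    simp only [Matrix.mul_apply, Matrix.hadamard_apply, Matrix.star_apply, h2, C,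
      Finset.sum_mul, Finset.mul_sum]
    rw [Finset.sum_comm]
    conv_rhs => rw [Finset.sum_comm]
    refine Finset.sum_congr rfl fun a _ => ?_
    conv_rhs => rw [Finset.sum_comm]
    refine Finset.sum_congr rfl fun b _ => Finset.sum_congr rfl fun k _ => ?_
    ring
  have hds : (Matrix.of fun k j => (C k j).re) ∈ doublyStochastic ℝ (Fin n) := by
    rw [mem_doublyStochastic_iff_sum]
    refine ⟨fun k j => (Complex.le_def.1 (hC0 k j)).1, fun k => ?_, fun j => ?_⟩
    · have := congrArg Complex.re (hrow k)
      simpa using this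
    · have := congrArg Complex.re (hcol j)
      simpa using this
  have := diag_ds hN l _ hds
  rw [eH, eK]
  convert this using 4 with k
  rw [hmk]
  push_cast
  refine Finset.sum_congr rfl fun j _ => ?_
  rw [Matrix.of_apply, hCr]

lemma main_herm (hN : UINorm N) (H Y : Matrix (Fin n) (Fin n) ℂ) (hH : H.IsHermitian)
    (hY : Y.PosDef) : N (Matrix.hadamard H Y) ≤ (⨆ i, (Y i i).re) * N H := by
  set c := ⨆ i, (Y i i).re with hc
  have hle : ∀ i, (Y i i).re ≤ c := fun i =>
    le_ciSup (f := fun i => (Y i i).re) (Set.finite_range _).bddAbove i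
  have hpos : ∀ i, 0 < (Y i i).re := fun i => (Complex.lt_def.1 (hY.diag_pos (i := i))).1
  have hre : ∀ i, Y i i = ((Y i i).re : ℂ) := by
    intro i
    have := (Complex.lt_def.1 (hY.diag_pos (i := i))).2
    apply Complex.ext <;> simp
    simpa using this.symm
  have hc0 : 0 ≤ c := Real.iSup_nonneg fun i => (hpos i).le
  let s : Fin n → ℝ := fun i => Real.sqrt (Y i i).re
  have hs : ∀ i, 0 < s i := fun i => Real.sqrt_pos.2 (hpos i)
  have hss : ∀ i, s i * s i = (Y i i).re := fun i => Real.mul_self_sqrt (hpos i).le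
  let E : Matrix (Fin n) (Fin n) ℂ := Matrix.diagonal fun i => (((s i)⁻¹ : ℝ) : ℂ)
  have hE : Eᴴ = E := by
    simp only [E, Matrix.diagonal_conjTranspose]
    congr 1
    funext i
    simp
  let Z := Eᴴ * Y * E
  have hZ : Z.PosSemidef := hY.posSemidef.conjTranspose_mul_mul_same E
  have hZe : ∀ i j, Z i j = (((s i)⁻¹ : ℝ) : ℂ) * Y i j * (((s j)⁻¹ : ℝ) : ℂ) := by
    intro i j
    simp only [Z, hE]
    simp only [E, Matrix.mul_diagonal, Matrix.diagonal_mul]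
  have hZd : ∀ i, Z i i = 1 := by
    intro i
    rw [hZe, hre i, ← hss i]
    have := (hs i).ne'
    norm_cast
    field_simp
  let d : Fin n → ℝ := fun i => s i / Real.sqrt c
  have hd0 : ∀ i, 0 ≤ d i := fun i => div_nonneg (hs i).le (Real.sqrt_nonneg _)
  have hd1 : ∀ i, d i ≤ 1 := fun i =>
    div_le_one_of_le₀ (Real.sqrt_le_sqrt (hle i)) (Real.sqrt_nonneg _)
  let D : Matrix (Fin n) (Fin n) ℂ := Matrix.diagonal fun i => (d i : ℂ)
  have key : Matrix.hadamard H Y = (c : ℂ) • (D * (Matrix.hadamard H Z * D)) := by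
    ext i j
    have hcp : 0 < c := (hpos i).trans_le (hle i)
    have hq : (Real.sqrt c : ℂ) * (Real.sqrt c : ℂ) = (c : ℂ) := by
      exact_mod_cast Real.mul_self_sqrt hc0
    have hq0 : (Real.sqrt c : ℂ) ≠ 0 := by
      exact_mod_cast (Real.sqrt_pos.2 hcp).ne'
    have hi : (s i : ℂ) ≠ 0 := by exact_mod_cast (hs i).ne'
    have hj : (s j : ℂ) ≠ 0 := by exact_mod_cast (hs j).ne'
    simp only [D, d, Matrix.smul_apply, Matrix.diagonal_mul, Matrix.mul_diagonal,
      Matrix.hadamard_apply, hZe, smul_eq_mul]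
    rw [← hq]
    push_cast
    field_simp
  rw [key, hN.smul, Complex.norm_real, Real.norm_of_nonneg hc0]
  refine mul_le_mul_of_nonneg_left ?_ hc0
  exact (contr_left hN d hd0 hd1 _).trans ((contr_right hN d hd0 hd1 _).trans
    (corr hN H Z hH hZ hZd))

end helpers

theorem stmt_14 {n : ℕ} (N : Matrix (Fin n) (Fin n) ℂ → ℝ)
    (hN0 : ∀ A : Matrix (Fin n) (Fin n) ℂ, N A = 0 ↔ A = 0)
    (hNs : ∀ (c : ℂ) (A : Matrix (Fin n) (Fin n) ℂ), N (c • A) = ‖c‖ * N A)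
    (hNa : ∀ A B : Matrix (Fin n) (Fin n) ℂ, N (A + B) ≤ N A + N B)
    (hUI : ∀ U V A : Matrix (Fin n) (Fin n) ℂ, U ∈ Matrix.unitaryGroup (Fin n) ℂ →
      V ∈ Matrix.unitaryGroup (Fin n) ℂ → N (U * A * V) = N A)
    (X Y : Matrix (Fin n) (Fin n) ℂ) (hY : Y.PosDef) :
    gnr N (Matrix.hadamard X Y) ≤ (⨆ i, (Y i i).re) * gnr N X := by
  have hN : UINorm N := ⟨hN0, hNs, hNa, hUI⟩
  have hc0 : 0 ≤ ⨆ i, (Y i i).re :=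
    Real.iSup_nonneg fun i => (Complex.lt_def.1 (hY.diag_pos (i := i))).1.le
  have hbdd : BddAbove (Set.range fun θ : ℝ => N (matRe (Complex.exp (θ * Complex.I) • X))) := by
    refine ⟨1 / 2 * (N X + N Xᴴ), ?_⟩
    rintro _ ⟨θ, rfl⟩
    simp only [matRe]
    rw [hNs, Matrix.conjTranspose_smul]
    have h1 := hNa (Complex.exp (θ * Complex.I) • X) (star (Complex.exp (θ * Complex.I)) • Xᴴ)
    rw [hNs, hNs, norm_star, Complex.norm_exp_ofReal_mul_I, one_mul, one_mul] at h1
    have : ‖(1 / 2 : ℂ)‖ = 1 / 2 := by simp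
    rw [this]
    linarith
  refine ciSup_le fun θ => ?_
  have h1 : matRe (Complex.exp (θ * Complex.I) • Matrix.hadamard X Y) =
      Matrix.hadamard (matRe (Complex.exp (θ * Complex.I) • X)) Y := by
    ext i j
    have h2 : star (Y j i) = Y i j := congrFun (congrFun hY.1 i) j
    simp only [matRe, Matrix.smul_apply, Matrix.add_apply, Matrix.conjTranspose_apply,
      Matrix.hadamard_apply, smul_eq_mul, star_mul', h2]
    ring
  have hH : (matRe (Complex.exp (θ * Complex.I) • X)).IsHermitian := by
    ext i j
    simp [matRe, add_comm]
    ring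
  rw [h1]
  refine (main_herm hN _ Y hH hY).trans ?_
  exact mul_le_mul_of_nonneg_left (le_ciSup hbdd θ) hc0
end

section
/- Let N be a submultiplicative, unitarily invariant norm on the n×n complex matrices and let α ∈ [0, π/2). If X, Y ∈ M_n both have numerical range contained in the sector S_α, then ω_N(X ∘ Y) ≤ (1 + tan α)·min{ ω_N(Re(X))·ω_N(Y), ω_N(X)·ω_N(Re(Y)) }; consequently ω_N(X ∘ Y) ≤ (1 + tan α)·ω_N(X)·ω_N(Y). -/
open scoped ComplexOrder Matrix

section aux

open Matrix

variable {n : ℕ} {N : Matrix (Fin n) (Fin n) ℂ → ℝ}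

lemma aux_nonneg (hNs : ∀ (c : ℂ) (A : Matrix (Fin n) (Fin n) ℂ), N (c • A) = ‖c‖ * N A)
    (hNa : ∀ A B : Matrix (Fin n) (Fin n) ℂ, N (A + B) ≤ N A + N B)
    (A : Matrix (Fin n) (Fin n) ℂ) : 0 ≤ N A := by
  have h0 : N 0 = 0 := by simpa using hNs 0 0
  have h1 := hNa A ((-1 : ℂ) • A)
  rw [hNs] at h1
  have : A + (-1 : ℂ) • A = 0 := by simp
  rw [this, h0] at h1
  simp at h1
  linarith

lemma aux_split (w v : ℂ) (h : ‖w‖ ≤ ‖v‖) :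
    ∃ e f : ℂ, ‖e‖ = 1 ∧ ‖f‖ = 1 ∧ w = (1 / 2 : ℂ) * (e * v + f * v) := by
  by_cases hv : v = 0
  · subst hv
    have : w = 0 := by simpa using h
    exact ⟨1, 1, by simp, by simp, by simp [this]⟩
  set d := w / v with hd
  have hd1 : ‖d‖ ≤ 1 := by
    rw [hd, norm_div]
    exact div_le_one_of_le₀ h (norm_nonneg _)
  have hw : w = d * v := by rw [hd]; field_simp
  set φ := Real.arccos ‖d‖
  have hc : Real.cos φ = ‖d‖ := Real.cos_arccos (by linarith [norm_nonneg d]) hd1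
  refine ⟨Complex.exp ((d.arg + φ : ℝ) * Complex.I), Complex.exp ((d.arg - φ : ℝ) * Complex.I),
    Complex.norm_exp_ofReal_mul_I _, Complex.norm_exp_ofReal_mul_I _, ?_⟩
  have h2 : d = (Real.cos φ : ℂ) * Complex.exp (d.arg * Complex.I) := by
    rw [hc]; exact (Complex.norm_mul_exp_arg_mul_I d).symm
  have e1 : Complex.exp ((d.arg + φ : ℝ) * Complex.I) =
      Complex.exp (d.arg * Complex.I) * Complex.exp (φ * Complex.I) := by
    rw [← Complex.exp_add]; push_cast; ring_nf
  have e2 : Complex.exp ((d.arg - φ : ℝ) * Complex.I) =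
      Complex.exp (d.arg * Complex.I) * Complex.exp (-φ * Complex.I) := by
    rw [← Complex.exp_add]; push_cast; ring_nf
  rw [e1, e2, hw]
  nth_rewrite 1 [h2]
  rw [Complex.ofReal_cos, Complex.cos]
  ring

lemma aux_diag_unitary (e : Fin n → ℂ) (he : ∀ i, ‖e i‖ = 1) :
    diagonal e ∈ Matrix.unitaryGroup (Fin n) ℂ := by
  rw [Matrix.mem_unitaryGroup_iff, Matrix.star_eq_conjTranspose, diagonal_conjTranspose,
    diagonal_mul_diagonal, ← diagonal_one]
  congr 1
  funext i
  simp [Complex.mul_conj, Complex.normSq_eq_norm_sq, he]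

lemma aux_mono (hNs : ∀ (c : ℂ) (A : Matrix (Fin n) (Fin n) ℂ), N (c • A) = ‖c‖ * N A)
    (hNa : ∀ A B : Matrix (Fin n) (Fin n) ℂ, N (A + B) ≤ N A + N B)
    (hUI : ∀ U V A : Matrix (Fin n) (Fin n) ℂ, U ∈ Matrix.unitaryGroup (Fin n) ℂ →
      V ∈ Matrix.unitaryGroup (Fin n) ℂ → N (U * A * V) = N A)
    (w v : Fin n → ℂ) (h : ∀ i, ‖w i‖ ≤ ‖v i‖) : N (diagonal w) ≤ N (diagonal v) := by
  choose e f he hf hw using fun i => aux_split (w i) (v i) (h i)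
  have h1 : diagonal w = (1 / 2 : ℂ) • (diagonal e * diagonal v * 1 + diagonal f * diagonal v * 1) := by
    rw [mul_one, mul_one, diagonal_mul_diagonal, diagonal_mul_diagonal, diagonal_add,
      ← diagonal_smul]
    congr 1
    funext i
    simpa using hw i
  rw [h1, hNs]
  have h2 := hNa (diagonal e * diagonal v * 1) (diagonal f * diagonal v * 1)
  rw [hUI _ _ _ (aux_diag_unitary e he) (one_mem _),
    hUI _ _ _ (aux_diag_unitary f hf) (one_mem _)] at h2
  have h3 : ‖(1 / 2 : ℂ)‖ = 1 / 2 := by norm_num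
  rw [h3]
  linarith

lemma aux_perm (hUI : ∀ U V A : Matrix (Fin n) (Fin n) ℂ, U ∈ Matrix.unitaryGroup (Fin n) ℂ →
      V ∈ Matrix.unitaryGroup (Fin n) ℂ → N (U * A * V) = N A)
    (σ : Equiv.Perm (Fin n)) (v : Fin n → ℂ) : N (diagonal (v ∘ σ)) = N (diagonal v) := by
  have hu : ∀ τ : Equiv.Perm (Fin n), τ.permMatrix ℂ ∈ Matrix.unitaryGroup (Fin n) ℂ := by
    intro τ
    rw [Matrix.mem_unitaryGroup_iff, Matrix.star_eq_conjTranspose, conjTranspose_permMatrix,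
      ← permMatrix_mul]
    simp
  rw [← hUI _ _ (diagonal v) (hu σ) (hu σ⁻¹)]
  congr 1
  rw [Equiv.Perm.permMatrix, PEquiv.toMatrix_toPEquiv_mul, Equiv.Perm.permMatrix,
    PEquiv.mul_toMatrix_toPEquiv]
  ext i j
  have hs : (Equiv.symm σ⁻¹) j = σ j := rfl
  simp [diagonal_apply, hs]

lemma aux_ds (hNs : ∀ (c : ℂ) (A : Matrix (Fin n) (Fin n) ℂ), N (c • A) = ‖c‖ * N A)
    (hNa : ∀ A B : Matrix (Fin n) (Fin n) ℂ, N (A + B) ≤ N A + N B)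
    (hUI : ∀ U V A : Matrix (Fin n) (Fin n) ℂ, U ∈ Matrix.unitaryGroup (Fin n) ℂ →
      V ∈ Matrix.unitaryGroup (Fin n) ℂ → N (U * A * V) = N A)
    (S : Matrix (Fin n) (Fin n) ℝ) (hS : S ∈ doublyStochastic ℝ (Fin n)) (s : Fin n → ℝ) :
    N (diagonal fun m => ((∑ l, S m l * s l : ℝ) : ℂ)) ≤ N (diagonal fun m => (s m : ℂ)) := by
  obtain ⟨c, hc0, hc1, hc⟩ := exists_eq_sum_perm_of_mem_doublyStochastic hS
  have h0 : N 0 = 0 := by simpa using hNs 0 0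
  have h1 : (diagonal fun m => ((∑ l, S m l * s l : ℝ) : ℂ)) =
      ∑ σ : Equiv.Perm (Fin n), (c σ : ℂ) • diagonal ((fun m => (s m : ℂ)) ∘ σ) := by
    have h2 : ∀ m, ∑ l, S m l * s l = ∑ σ : Equiv.Perm (Fin n), c σ * s (σ m) := by
      intro m
      have : ∑ l, S m l * s l = (S *ᵥ s) m := rfl
      rw [this, ← hc, sum_mulVec]
      simp [smul_mulVec, permMatrix_mulVec]
    ext i j
    by_cases hij : i = j
    · subst hij
      rw [diagonal_apply_eq, h2, Matrix.sum_apply]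
      simp
    · simp [hij, Matrix.sum_apply]
  rw [h1]
  calc _ ≤ ∑ σ : Equiv.Perm (Fin n), N ((c σ : ℂ) • diagonal ((fun m => (s m : ℂ)) ∘ σ)) :=
        Finset.le_sum_of_subadditive N h0.le hNa _ _
    _ = ∑ σ : Equiv.Perm (Fin n), c σ * N (diagonal fun m => (s m : ℂ)) := by
        refine Finset.sum_congr rfl fun σ _ => ?_
        rw [hNs, aux_perm hUI]
        simp [abs_of_nonneg (hc0 σ)]
    _ = _ := by rw [← Finset.sum_mul, hc1, one_mul]

/-- The quadratic form of a matrix. -/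
noncomputable def auxQf (M : Matrix (Fin n) (Fin n) ℂ) (q : Fin n → ℂ) : ℂ :=
  ∑ i, ∑ j, star (q i) * M i j * q j

lemma auxQf_eq (M : Matrix (Fin n) (Fin n) ℂ) (q : Fin n → ℂ) :
    auxQf M q = star q ⬝ᵥ M *ᵥ q := by
  simp [auxQf, dotProduct, mulVec, Finset.mul_sum, mul_assoc]

lemma auxQf_add (M M' : Matrix (Fin n) (Fin n) ℂ) (q : Fin n → ℂ) :
    auxQf (M + M') q = auxQf M q + auxQf M' q := by
  simp [auxQf_eq, add_mulVec]

lemma auxQf_smul (c : ℂ) (M : Matrix (Fin n) (Fin n) ℂ) (q : Fin n → ℂ) :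
    auxQf (c • M) q = c * auxQf M q := by
  simp [auxQf_eq, smul_mulVec]

lemma auxQf_conjTranspose (M : Matrix (Fin n) (Fin n) ℂ) (q : Fin n → ℂ) :
    auxQf Mᴴ q = star (auxQf M q) := by
  simp only [auxQf, star_sum, conjTranspose_apply]
  rw [Finset.sum_comm]
  refine Finset.sum_congr rfl fun i _ => Finset.sum_congr rfl fun j _ => ?_
  simp only [star_mul', star_star]
  ring

lemma auxQf_diagonal (d : Fin n → ℂ) (q : Fin n → ℂ) :
    auxQf (diagonal d) q = ∑ i, d i * ((‖q i‖ ^ 2 : ℝ) : ℂ) := by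
  simp only [auxQf, diagonal_apply]
  refine Finset.sum_congr rfl fun i _ => ?_
  rw [Finset.sum_eq_single i (by intro j _ hj; simp [hj.symm]) (by simp)]
  have : star (q i) * q i = ((‖q i‖ ^ 2 : ℝ) : ℂ) := by
    rw [mul_comm, Complex.star_def, Complex.mul_conj, Complex.normSq_eq_norm_sq]
  rw [← this]; simp; ring

lemma aux_sum (a : ℂ) (A U V : Matrix (Fin n) (Fin n) ℂ) (hA : ∀ i, A i i = a)
    (hV : ∀ i j, ∑ l, V i l * star (V j l) = if i = j then 1 else 0) 
    (m : Fin n) (hU : ∑ i, star (U i m) * U i m = 1) :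
    ∑ l, auxQf A (fun i => U i m * star (V i l)) = a := by
  simp only [auxQf]
  rw [Finset.sum_comm]
  have h1 : ∀ i, ∑ l, ∑ j, star (U i m * star (V i l)) * A i j * (U j m * star (V j l)) =
      a * (star (U i m) * U i m) := by
    intro i
    rw [Finset.sum_comm]
    have h2 : ∀ j, ∑ l, star (U i m * star (V i l)) * A i j * (U j m * star (V j l)) =
        star (U i m) * A i j * U j m * (if i = j then 1 else 0) := by
      intro j
      rw [← hV i j, Finset.mul_sum]
      refine Finset.sum_congr rfl fun l _ => ?_
      simp only [star_mul', star_star]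
      ring
    simp only [h2]
    simp [hA]
    ring
  simp only [h1]
  rw [← Finset.mul_sum, hU, mul_one]

lemma aux_eig (B U V : Matrix (Fin n) (Fin n) ℂ) (lam : Fin n → ℂ) (m : Fin n) :
    (star U * (B ⊙ (V * diagonal lam * star V)) * U) m m =
      ∑ l, lam l * auxQf B (fun i => U i m * star (V i l)) := by
  have hd : ∀ i l, (V * diagonal lam) i l = V i l * lam l := fun i l => mul_diagonal ..
  rw [mul_apply]
  simp only [mul_apply (M := star U), hadamard_apply, mul_apply (M := V * diagonal lam), hd,
    star_apply, auxQf, Finset.sum_mul, Finset.mul_sum]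
  rw [Finset.sum_comm]
  conv_rhs => rw [Finset.sum_comm]
  refine Finset.sum_congr rfl fun i _ => ?_
  conv_rhs => rw [Finset.sum_comm]
  refine Finset.sum_congr rfl fun j _ => Finset.sum_congr rfl fun l _ => ?_
  simp only [star_mul', star_star]
  ring

lemma aux_key0 (hNs : ∀ (c : ℂ) (A : Matrix (Fin n) (Fin n) ℂ), N (c • A) = ‖c‖ * N A)
    (hNa : ∀ A B : Matrix (Fin n) (Fin n) ℂ, N (A + B) ≤ N A + N B)
    (hUI : ∀ U V A : Matrix (Fin n) (Fin n) ℂ, U ∈ Matrix.unitaryGroup (Fin n) ℂ →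
      V ∈ Matrix.unitaryGroup (Fin n) ℂ → N (U * A * V) = N A)
    (A B Z : Matrix (Fin n) (Fin n) ℂ) (hB : B.IsHermitian) (hZ : Z.IsHermitian)
    (a t : ℝ) (ha : 0 < a) (ht : 0 ≤ t) (hAd : ∀ i, A i i = a)
    (hA : ∀ q, 0 ≤ (auxQf A q).re) (hBq : ∀ q, ‖auxQf B q‖ ≤ t * (auxQf A q).re) :
    N (B ⊙ Z) ≤ t * a * N Z := by
  have hW : (B ⊙ Z).IsHermitian := by
    ext i j
    have h1 := hB.apply i j
    have h2 := hZ.apply i j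
    simp only [conjTranspose_apply, hadamard_apply, star_mul', h1, h2]
  obtain ⟨U, hU, w, hWU⟩ : ∃ U ∈ Matrix.unitaryGroup (Fin n) ℂ, ∃ w : Fin n → ℂ,
      B ⊙ Z = U * diagonal w * star U :=
    ⟨_, hW.eigenvectorUnitary.2, _, hW.spectral_theorem⟩
  obtain ⟨V, hV, lam, hZV⟩ : ∃ U ∈ Matrix.unitaryGroup (Fin n) ℂ, ∃ w : Fin n → ℂ,
      Z = U * diagonal w * star U :=
    ⟨_, hZ.eigenvectorUnitary.2, _, hZ.spectral_theorem⟩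
  have hUs : star U ∈ Matrix.unitaryGroup (Fin n) ℂ := Unitary.star_mem hU
  have hVs : star V ∈ Matrix.unitaryGroup (Fin n) ℂ := Unitary.star_mem hV
  have hU1 := Matrix.mem_unitaryGroup_iff.1 hU
  have hU2 := Matrix.mem_unitaryGroup_iff'.1 hU
  have hV1 := Matrix.mem_unitaryGroup_iff.1 hV
  have hV2 := Matrix.mem_unitaryGroup_iff'.1 hV
  have hw : ∀ m, w m = ∑ l, lam l * auxQf B (fun i => U i m * star (V i l)) := by
    intro m
    rw [← aux_eig, ← hZV, hWU]
    have : star U * (U * diagonal w * star U) * U = (star U * U) * diagonal w * (star U * U) := by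
      simp only [Matrix.mul_assoc]
    rw [this, hU2]
    simp
  have entry1 : ∀ {T : Matrix (Fin n) (Fin n) ℂ}, T * star T = 1 → ∀ i j,
      ∑ l, T i l * star (T j l) = if i = j then 1 else 0 := by
    intro T hT i j
    have := congrFun (congrFun hT i) j
    simpa [mul_apply, one_apply, star_apply] using this
  have entry2 : ∀ {T : Matrix (Fin n) (Fin n) ℂ}, star T * T = 1 → ∀ m,
      ∑ i, star (T i m) * T i m = 1 := by
    intro T hT i
    have := congrFun (congrFun hT i) i
    simpa [mul_apply, one_apply, star_apply] using this
  have row : ∀ m, ∑ l, auxQf A (fun i => U i m * star (V i l)) = a := fun m =>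
    aux_sum a A U V hAd (entry1 hV1) m (entry2 hU2 m)
  have col : ∀ l, ∑ m, auxQf A (fun i => U i m * star (V i l)) = a := by
    intro l
    have := aux_sum a A (V.map star) (U.map star) hAd (by
      intro i j
      have h := congrArg star (entry1 hU1 i j)
      rw [star_sum] at h
      simp only [map_apply, star_star]
      simp only [star_mul', star_star] at h
      rw [h]; split_ifs <;> simp) l (by
      have h := congrArg star (entry2 hV2 l)
      rw [star_sum] at h
      simp only [map_apply, star_star]
      simp only [star_mul', star_star] at h
      rw [h]; simp)
    rw [← this]
    refine Finset.sum_congr rfl fun m _ => ?_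
    congr 1
    funext i
    simp [mul_comm]
  set S : Matrix (Fin n) (Fin n) ℝ :=
    Matrix.of fun m l => (auxQf A (fun i => U i m * star (V i l))).re / a with hS
  have hSd : S ∈ doublyStochastic ℝ (Fin n) := by
    rw [mem_doublyStochastic_iff_sum]
    refine ⟨fun m l => div_nonneg (hA _) ha.le, fun m => ?_, fun l => ?_⟩
    · simp only [hS, of_apply]
      rw [← Finset.sum_div, ← Complex.re_sum, row, Complex.ofReal_re, div_self ha.ne']
    · simp only [hS, of_apply]
      rw [← Finset.sum_div, ← Complex.re_sum, col, Complex.ofReal_re, div_self ha.ne']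
  have hNZ : N Z = N (diagonal lam) := by
    rw [hZV]; exact hUI _ _ _ hV hVs
  have hNW : N (B ⊙ Z) = N (diagonal w) := by
    rw [hWU]; exact hUI _ _ _ hU hUs
  rw [hNZ, hNW]
  have h1 : N (diagonal w) ≤
      N (((t * a : ℝ) : ℂ) • diagonal fun m => ((∑ l, S m l * ‖lam l‖ : ℝ) : ℂ)) := by
    rw [← diagonal_smul]
    apply aux_mono hNs hNa hUI
    intro m
    have hnn : 0 ≤ ∑ l, S m l * ‖lam l‖ := Finset.sum_nonneg fun l _ =>
      mul_nonneg (nonneg_of_mem_doublyStochastic hSd) (norm_nonneg _)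
    rw [Pi.smul_apply, smul_eq_mul, ← Complex.ofReal_mul, Complex.norm_real, Real.norm_eq_abs,
      abs_of_nonneg (by positivity), hw, Finset.mul_sum]
    refine (norm_sum_le _ _).trans (Finset.sum_le_sum fun l _ => ?_)
    rw [norm_mul]
    have h2 := hBq (fun i => U i m * star (V i l))
    have h3 : t * a * (S m l * ‖lam l‖) =
        ‖lam l‖ * (t * (auxQf A (fun i => U i m * star (V i l))).re) := by
      simp only [hS, of_apply]; field_simp
    rw [h3]
    exact mul_le_mul_of_nonneg_left h2 (norm_nonneg _)
  rw [hNs, Complex.norm_real, Real.norm_eq_abs, abs_of_nonneg (by positivity)] at h1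
  refine h1.trans (mul_le_mul_of_nonneg_left ?_ (by positivity))
  refine (aux_ds hNs hNa hUI S hSd _).trans (aux_mono hNs hNa hUI _ _ fun i => ?_)
  simp

lemma aux_key (hNs : ∀ (c : ℂ) (A : Matrix (Fin n) (Fin n) ℂ), N (c • A) = ‖c‖ * N A)
    (hNa : ∀ A B : Matrix (Fin n) (Fin n) ℂ, N (A + B) ≤ N A + N B)
    (hUI : ∀ U V A : Matrix (Fin n) (Fin n) ℂ, U ∈ Matrix.unitaryGroup (Fin n) ℂ →
      V ∈ Matrix.unitaryGroup (Fin n) ℂ → N (U * A * V) = N A)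
    (A B Z : Matrix (Fin n) (Fin n) ℂ) (hB : B.IsHermitian) (hZ : Z.IsHermitian)
    (hAH : A.IsHermitian)
    (a t : ℝ) (ha : 0 < a) (ht : 0 ≤ t) (hAd : ∀ i, (A i i).re ≤ a)
    (hA : ∀ q, 0 ≤ (auxQf A q).re) (hBq : ∀ q, ‖auxQf B q‖ ≤ t * (auxQf A q).re) :
    N (B ⊙ Z) ≤ t * a * N Z := by
  have hge : ∀ q, (auxQf A q).re ≤
      (auxQf (A + diagonal fun i => ((a - (A i i).re : ℝ) : ℂ)) q).re := by
    intro q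
    rw [auxQf_add, auxQf_diagonal, Complex.add_re, Complex.re_sum]
    have : 0 ≤ ∑ i, (((a - (A i i).re : ℝ) : ℂ) * ((‖q i‖ ^ 2 : ℝ) : ℂ)).re := by
      refine Finset.sum_nonneg fun i _ => ?_
      rw [← Complex.ofReal_mul, Complex.ofReal_re]
      have := hAd i
      exact mul_nonneg (by linarith) (by positivity)
    linarith
  refine aux_key0 hNs hNa hUI (A + diagonal fun i => ((a - (A i i).re : ℝ) : ℂ)) B Z hB hZ a t ha ht
    ?_ (fun q => (hA q).trans (hge q))
    (fun q => (hBq q).trans (mul_le_mul_of_nonneg_left (hge q) ht))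
  intro i
  have h1 : ((A i i).re : ℂ) = A i i := Complex.conj_eq_iff_re.1 (hAH.apply i i)
  simp [h1]

lemma aux_diag_le (hN0 : ∀ A : Matrix (Fin n) (Fin n) ℂ, N A = 0 ↔ A = 0)
    (hNs : ∀ (c : ℂ) (A : Matrix (Fin n) (Fin n) ℂ), N (c • A) = ‖c‖ * N A)
    (hNa : ∀ A B : Matrix (Fin n) (Fin n) ℂ, N (A + B) ≤ N A + N B)
    (hSM : ∀ A B : Matrix (Fin n) (Fin n) ℂ, N (A * B) ≤ N A * N B)
    (A : Matrix (Fin n) (Fin n) ℂ) (hA : A.IsHermitian) (i : Fin n) : ‖A i i‖ ≤ N A := by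
  have hnn := aux_nonneg hNs hNa
  set E : Matrix (Fin n) (Fin n) ℂ := Matrix.single i i 1 with hE
  have hEpos : 0 < N E := by
    refine lt_of_le_of_ne (hnn _) fun h => ?_
    have h1 := (hN0 E).1 h.symm
    have h2 := congrFun (congrFun h1 i) i
    simp [hE] at h2
  have hbd : ∀ C : Matrix (Fin n) (Fin n) ℂ, ‖C i i‖ ≤ N E * N C := by
    intro C
    have h1 : E * C * E = (C i i) • E := by
      ext k l
      simp only [hE, Matrix.smul_apply, Matrix.mul_apply, Matrix.single_apply]
      by_cases hk : i = k <;> by_cases hl : i = l <;> simp [hk, hl] <;> aesop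
    have h2 : N (E * C * E) ≤ N E * N C * N E :=
      (hSM _ _).trans (mul_le_mul_of_nonneg_right (hSM _ _) (hnn _))
    rw [h1, hNs] at h2
    exact le_of_mul_le_mul_right h2 hEpos
  have hpow : ∀ k : ℕ, ∃ C : Matrix (Fin n) (Fin n) ℂ, C.IsHermitian ∧ ‖A i i‖ ^ (2 ^ k) ≤ ‖C i i‖ ∧
      N C ≤ N A ^ (2 ^ k) := by
    intro k
    induction k with
    | zero => exact ⟨A, hA, by simp, by simp⟩
    | succ k ih =>
      obtain ⟨C, hC, h1, h2⟩ := ih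
      refine ⟨C * C, ?_, ?_, ?_⟩
      · rw [Matrix.IsHermitian, conjTranspose_mul, hC.eq]
      · have h3 : (C * C) i i = ((∑ j, ‖C i j‖ ^ 2 : ℝ) : ℂ) := by
          rw [mul_apply]
          push_cast
          refine Finset.sum_congr rfl fun j _ => ?_
          rw [← hC.apply j i, Complex.star_def, Complex.mul_conj, Complex.normSq_eq_norm_sq]
          push_cast
          rfl
        rw [h3, Complex.norm_real, Real.norm_eq_abs, abs_of_nonneg (by positivity), pow_succ, pow_mul]
        calc (‖A i i‖ ^ (2 ^ k)) ^ 2 ≤ ‖C i i‖ ^ 2 := by gcongr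
          _ ≤ _ := Finset.single_le_sum (f := fun j => ‖C i j‖ ^ 2)
            (fun j _ => by positivity) (Finset.mem_univ i)
      · rw [pow_succ, pow_mul, sq]
        exact (hSM _ _).trans (mul_le_mul h2 h2 (hnn _) (by have := hnn A; positivity))
  by_contra! hlt
  have hall : ∀ k : ℕ, ‖A i i‖ ^ (2 ^ k) ≤ N E * N A ^ (2 ^ k) := by
    intro k
    obtain ⟨C, _, h1, h2⟩ := hpow k
    exact h1.trans ((hbd C).trans (mul_le_mul_of_nonneg_left h2 hEpos.le))
  have hNA : 0 < N A := by
    refine lt_of_le_of_ne (hnn _) fun h => ?_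
    have := (hN0 A).1 h.symm
    rw [this] at hlt
    have h0 := hnn (0 : Matrix (Fin n) (Fin n) ℂ)
    simp at hlt
    linarith
  set r := ‖A i i‖ / N A
  have hr : 1 < r := (one_lt_div hNA).2 hlt
  have hrk : ∀ k : ℕ, r ^ (2 ^ k) ≤ N E := by
    intro k
    rw [div_pow, div_le_iff₀ (by positivity)]
    exact hall k
  obtain ⟨k, hk⟩ := pow_unbounded_of_one_lt (N E) hr
  have := pow_le_pow_right₀ hr.le (Nat.lt_two_pow_self (n := k)).le
  linarith [hrk k]

lemma aux_matRe_herm (X : Matrix (Fin n) (Fin n) ℂ) : (matRe X).IsHermitian := by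
  rw [Matrix.IsHermitian, matRe, conjTranspose_smul, conjTranspose_add, conjTranspose_conjTranspose,
    add_comm]
  simp

lemma aux_matIm_herm (X : Matrix (Fin n) (Fin n) ℂ) : (matIm X).IsHermitian := by
  rw [Matrix.IsHermitian, matIm, conjTranspose_smul, conjTranspose_sub, conjTranspose_conjTranspose,
    ← neg_sub X, smul_neg, ← neg_smul]
  simp

lemma aux_qf_re (X : Matrix (Fin n) (Fin n) ℂ) (q : Fin n → ℂ) :
    auxQf (matRe X) q = ((auxQf X q).re : ℂ) := by
  rw [matRe, auxQf_smul, auxQf_add, auxQf_conjTranspose, Complex.star_def, Complex.add_conj]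
  push_cast; ring

lemma aux_qf_im (X : Matrix (Fin n) (Fin n) ℂ) (q : Fin n → ℂ) :
    auxQf (matIm X) q = ((auxQf X q).im : ℂ) := by
  have h : X - Xᴴ = X + (-1 : ℂ) • Xᴴ := by simp [sub_eq_add_neg]
  rw [matIm, h, auxQf_smul, auxQf_add, auxQf_smul, auxQf_conjTranspose, Complex.star_def,
    neg_one_mul, ← sub_eq_add_neg, Complex.sub_conj]
  have := Complex.I_ne_zero
  push_cast; field_simp

lemma aux_sector {α : ℝ} (X : Matrix (Fin n) (Fin n) ℂ)
    (hX : numRange X ⊆ sector α) (q : Fin n → ℂ) :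
    0 ≤ (auxQf X q).re ∧ |(auxQf X q).im| ≤ Real.tan α * (auxQf X q).re := by
  set s : ℝ := ∑ i, ‖q i‖ ^ 2 with hs
  have hqq : star q ⬝ᵥ q = (s : ℂ) := by
    rw [hs, dotProduct]
    push_cast
    refine Finset.sum_congr rfl fun i _ => ?_
    rw [Pi.star_apply, mul_comm, Complex.star_def, Complex.mul_conj, Complex.normSq_eq_norm_sq]
    push_cast; rfl
  have hs0 : 0 ≤ s := Finset.sum_nonneg fun i _ => by positivity
  rcases hs0.eq_or_lt with h0 | hpos
  · have : q = 0 := by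
      have h1 := (Finset.sum_eq_zero_iff_of_nonneg (fun i _ => by positivity)).1 h0.symm
      funext i
      simpa using h1 i (Finset.mem_univ i)
    subst this
    simp [auxQf]
  · set c : ℝ := (Real.sqrt s)⁻¹ with hc
    have hc2 : c * c * s = 1 := by
      have h := Real.mul_self_sqrt hs0
      have h' : Real.sqrt s ≠ 0 := (Real.sqrt_pos.2 hpos).ne'
      rw [hc]; field_simp; nlinarith
    have hcc : 0 < c * c := by
      by_contra! h
      nlinarith
    have hsc : star ((c : ℂ) • q) = (c : ℂ) • star q := by
      rw [star_smul]; simp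
    have hmem : ((c * c : ℝ) : ℂ) * auxQf X q ∈ numRange X := by
      refine ⟨(c : ℂ) • q, ?_, ?_⟩
      · rw [hsc, smul_dotProduct, dotProduct_smul, hqq, smul_eq_mul, smul_eq_mul, ← mul_assoc]
        exact_mod_cast hc2
      · rw [hsc, mulVec_smul, smul_dotProduct, dotProduct_smul, ← auxQf_eq, smul_eq_mul,
          smul_eq_mul, ← mul_assoc]
        push_cast; rfl
    obtain ⟨h1, h2⟩ := hX hmem
    rw [Complex.re_ofReal_mul] at h1 h2
    rw [Complex.im_ofReal_mul, abs_mul, abs_of_pos hcc] at h2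
    refine ⟨(pos_of_mul_pos_right h1 hcc.le).le, ?_⟩
    refine le_of_mul_le_mul_left (h2.trans_eq ?_) hcc
    ring

lemma aux_bdd (hNs : ∀ (c : ℂ) (A : Matrix (Fin n) (Fin n) ℂ), N (c • A) = ‖c‖ * N A)
    (hNa : ∀ A B : Matrix (Fin n) (Fin n) ℂ, N (A + B) ≤ N A + N B)
    (X : Matrix (Fin n) (Fin n) ℂ) :
    BddAbove (Set.range fun θ : ℝ => N (matRe (Complex.exp (θ * Complex.I) • X))) := by
  refine ⟨N X + N Xᴴ, ?_⟩
  rintro _ ⟨θ, rfl⟩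
  have hnn := aux_nonneg hNs hNa
  have h := hNa (Complex.exp (θ * Complex.I) • X) (Complex.exp (θ * Complex.I) • X)ᴴ
  rw [conjTranspose_smul, hNs, hNs, norm_star, Complex.norm_exp_ofReal_mul_I] at h
  have h3 : ‖(1 / 2 : ℂ)‖ = 1 / 2 := by norm_num
  simp only [matRe, conjTranspose_smul]
  rw [hNs, h3]
  linarith [hnn X, hnn Xᴴ]

lemma aux_le_gnr (hNs : ∀ (c : ℂ) (A : Matrix (Fin n) (Fin n) ℂ), N (c • A) = ‖c‖ * N A)
    (hNa : ∀ A B : Matrix (Fin n) (Fin n) ℂ, N (A + B) ≤ N A + N B)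
    (X : Matrix (Fin n) (Fin n) ℂ) (c : ℂ) (hc : ‖c‖ = 1) : N (matRe (c • X)) ≤ gnr N X := by
  have h := le_ciSup (aux_bdd hNs hNa X) c.arg
  have h2 : Complex.exp (c.arg * Complex.I) = c := by
    have := Complex.norm_mul_exp_arg_mul_I c
    rwa [hc, Complex.ofReal_one, one_mul] at this
  simp only [h2] at h
  exact h

lemma aux_split_had (X Y : Matrix (Fin n) (Fin n) ℂ) (c : ℂ) :
    matRe (c • (X ⊙ Y)) = matRe X ⊙ matRe (c • Y) + matIm X ⊙ matRe ((c * Complex.I) • Y) := by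
  ext i j
  simp only [matRe, matIm, hadamard_apply, Matrix.add_apply, Matrix.sub_apply, Matrix.smul_apply, conjTranspose_apply,
    smul_eq_mul, star_mul', Complex.star_def, Complex.conj_I]
  have := Complex.I_ne_zero
  field_simp
  ring_nf

lemma aux_core (hN0 : ∀ A : Matrix (Fin n) (Fin n) ℂ, N A = 0 ↔ A = 0)
    (hNs : ∀ (c : ℂ) (A : Matrix (Fin n) (Fin n) ℂ), N (c • A) = ‖c‖ * N A)
    (hNa : ∀ A B : Matrix (Fin n) (Fin n) ℂ, N (A + B) ≤ N A + N B)
    (hUI : ∀ U V A : Matrix (Fin n) (Fin n) ℂ, U ∈ Matrix.unitaryGroup (Fin n) ℂ →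
      V ∈ Matrix.unitaryGroup (Fin n) ℂ → N (U * A * V) = N A)
    (hSM : ∀ A B : Matrix (Fin n) (Fin n) ℂ, N (A * B) ≤ N A * N B)
    {α : ℝ} (ht : 0 ≤ Real.tan α)
    (X Y : Matrix (Fin n) (Fin n) ℂ) (hX : numRange X ⊆ sector α) :
    gnr N (X ⊙ Y) ≤ (1 + Real.tan α) * N (matRe X) * gnr N Y := by
  have hnn := aux_nonneg hNs hNa
  have hAH := aux_matRe_herm X
  have hg : ∀ c : ℂ, ‖c‖ = 1 → N (matRe (c • Y)) ≤ gnr N Y := aux_le_gnr hNs hNa Y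
  have hg0 : 0 ≤ gnr N Y := (hnn _).trans (hg 1 (by simp))
  refine ciSup_le fun θ => ?_
  rcases (hnn (matRe X)).eq_or_lt with h0 | hpos
  · have hz := (hN0 _).1 h0.symm
    have hn : IsEmpty (Fin n) := by
      refine ⟨fun i => ?_⟩
      have hm : auxQf X (Pi.single i 1) ∈ numRange X :=
        ⟨Pi.single i 1, by simp, auxQf_eq _ _⟩
      have h1 := (hX hm).1
      have h2 := aux_qf_re X (Pi.single i 1)
      rw [hz] at h2
      have h3 : (auxQf X (Pi.single i 1)).re = 0 := by
        have : auxQf (0 : Matrix (Fin n) (Fin n) ℂ) (Pi.single i 1) = 0 := by simp [auxQf]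
        rw [this] at h2
        exact_mod_cast h2.symm
      linarith
    have : matRe (Complex.exp (θ * Complex.I) • (X ⊙ Y)) = 0 := Subsingleton.elim _ _
    rw [this, (hN0 0).2 rfl]
    have := hnn (matRe X)
    positivity
  · have hd : ∀ i, (matRe X i i).re ≤ N (matRe X) := fun i =>
      (Complex.re_le_norm _).trans (aux_diag_le hN0 hNs hNa hSM _ hAH i)
    have hq : ∀ q, 0 ≤ (auxQf (matRe X) q).re := fun q => by
      rw [aux_qf_re, Complex.ofReal_re]; exact (aux_sector X hX q).1
    set c := Complex.exp (θ * Complex.I)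
    have hc : ‖c‖ = 1 := Complex.norm_exp_ofReal_mul_I θ
    have h1 := aux_key hNs hNa hUI (matRe X) (matRe X) (matRe (c • Y)) hAH (aux_matRe_herm _) hAH
      (N (matRe X)) 1 hpos zero_le_one hd hq (fun q => by
        rw [one_mul, aux_qf_re, Complex.norm_real, Complex.ofReal_re, Real.norm_eq_abs,
          abs_of_nonneg (aux_sector X hX q).1])
    have h2 := aux_key hNs hNa hUI (matRe X) (matIm X) (matRe ((c * Complex.I) • Y))
      (aux_matIm_herm X) (aux_matRe_herm _) hAH
      (N (matRe X)) (Real.tan α) hpos ht hd hq (fun q => by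
        rw [aux_qf_re, aux_qf_im, Complex.norm_real, Complex.ofReal_re, Real.norm_eq_abs]
        exact (aux_sector X hX q).2)
    rw [aux_split_had]
    refine (hNa _ _).trans ?_
    have g1 := mul_le_mul_of_nonneg_left (hg c hc) hpos.le
    have g2 := mul_le_mul_of_nonneg_left (hg (c * Complex.I) (by simp [hc]))
      (mul_nonneg ht hpos.le)
    nlinarith

end aux

theorem stmt_19 {n : ℕ} (N : Matrix (Fin n) (Fin n) ℂ → ℝ)
    (hN0 : ∀ A : Matrix (Fin n) (Fin n) ℂ, N A = 0 ↔ A = 0)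
    (hNs : ∀ (c : ℂ) (A : Matrix (Fin n) (Fin n) ℂ), N (c • A) = ‖c‖ * N A)
    (hNa : ∀ A B : Matrix (Fin n) (Fin n) ℂ, N (A + B) ≤ N A + N B)
    (hUI : ∀ U V A : Matrix (Fin n) (Fin n) ℂ, U ∈ Matrix.unitaryGroup (Fin n) ℂ →
      V ∈ Matrix.unitaryGroup (Fin n) ℂ → N (U * A * V) = N A)
    (hSM : ∀ A B : Matrix (Fin n) (Fin n) ℂ, N (A * B) ≤ N A * N B)
    {α : ℝ} (hα0 : 0 ≤ α) (hα1 : α < Real.pi / 2)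
    (X Y : Matrix (Fin n) (Fin n) ℂ)
    (hX : numRange X ⊆ sector α) (hY : numRange Y ⊆ sector α) :
    gnr N (Matrix.hadamard X Y) ≤
        (1 + Real.tan α) * min (gnr N (matRe X) * gnr N Y) (gnr N X * gnr N (matRe Y)) ∧
      gnr N (Matrix.hadamard X Y) ≤ (1 + Real.tan α) * gnr N X * gnr N Y := by

  have ht : 0 ≤ Real.tan α := Real.tan_nonneg_of_nonneg_of_le_pi_div_two hα0 hα1.le
  have hnn := aux_nonneg hNs hNa
  have h1 := aux_core hN0 hNs hNa hUI hSM ht X Y hX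
  have h2 := aux_core hN0 hNs hNa hUI hSM ht Y X hY
  rw [Matrix.hadamard_comm] at h2
  have hle : ∀ Z, N (matRe Z) ≤ gnr N Z := fun Z => by
    simpa using aux_le_gnr hNs hNa Z 1 (by simp)
  have hle' : ∀ Z, N (matRe Z) ≤ gnr N (matRe Z) := fun Z => by
    have h : matRe (matRe Z) = matRe Z := by
      have h3 := (aux_matRe_herm Z).eq
      rw [matRe, h3, ← two_smul ℂ, smul_smul]
      norm_num
    have := hle (matRe Z)
    rwa [h] at this
  have hg : ∀ Z, 0 ≤ gnr N Z := fun Z => (hnn _).trans (hle Z)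
  have hp : 0 ≤ 1 + Real.tan α := by linarith
  refine ⟨?_, ?_⟩
  · rw [mul_min_of_nonneg _ _ hp]
    refine le_min (h1.trans ?_) (h2.trans ?_)
    · rw [mul_assoc]
      exact mul_le_mul_of_nonneg_left (mul_le_mul_of_nonneg_right (hle' X) (hg Y)) hp
    · rw [mul_assoc, mul_comm (gnr N X)]
      exact mul_le_mul_of_nonneg_left (mul_le_mul_of_nonneg_right (hle' Y) (hg X)) hp
  · refine h1.trans ?_
    rw [mul_assoc, mul_assoc]
    exact mul_le_mul_of_nonneg_left (mul_le_mul_of_nonneg_right (hle X) (hg Y)) hp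
end
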